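/- arXiv:1404.3152 — 2 statements merged into one kernel-verified Lean document; each statement's English description precedes it below -/
import Mathlib

section
/- Let Φ be a real M×N matrix (M ≤ N) with Φ Φᵀ invertible, Q = Φᵀ (Φ Φᵀ)⁻¹ Φ, and let s ∈ ℝ^N be supported on a set J ⊆ {1,…,N} (s_i = 0 for i ∉ J). Let Φ_J denote the submatrix of Φ formed by the columns indexed by J, and let λ_min and λ_max denote smallest and largest eigenvalues. Then λ_min(Φ_Jᵀ Φ_J) ‖s‖₂² / λ_max(Φ Φᵀ) ≤ ‖Q s‖₂² ≤ λ_max(Φ_Jᵀ Φ_J) ‖s‖₂² / λ_min(Φ Φᵀ). -/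
open Matrix

/-- The Euclidean (`ℓ₂`) norm of a vector in `ℝ^n`. -/
noncomputable def euclNorm {n : ℕ} (v : Fin n → ℝ) : ℝ :=
  Real.sqrt (∑ i, (v i) ^ 2)

/-- The smallest eigenvalue of a real square matrix, as the infimum of its spectrum. -/
noncomputable def lamMin {n : Type*} [Fintype n] [DecidableEq n]
    (A : Matrix n n ℝ) : ℝ :=
  sInf (spectrum ℝ A)

/-- The largest eigenvalue of a real square matrix, as the supremum of its spectrum. -/
noncomputable def lamMax {n : Type*} [Fintype n] [DecidableEq n]
    (A : Matrix n n ℝ) : ℝ :=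
  sSup (spectrum ℝ A)

theorem euclNorm_sq {n : ℕ} (v : Fin n → ℝ) : euclNorm v ^ 2 = v ⬝ᵥ v := by
  rw [euclNorm, Real.sq_sqrt (Finset.sum_nonneg fun i _ => sq_nonneg _)]
  simp [dotProduct, sq]

/-- The Cauchy–Schwarz inequality for the dot product. -/
theorem dotProduct_sq_le {n : Type*} [Fintype n] (v w : n → ℝ) :
    (v ⬝ᵥ w) ^ 2 ≤ (v ⬝ᵥ v) * (w ⬝ᵥ w) := by
  simpa [dotProduct, sq] using Finset.sum_mul_sq_le_sq_mul_sq Finset.univ v w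

theorem dotProduct_self_nonneg' {n : Type*} [Fintype n] (v : n → ℝ) : 0 ≤ v ⬝ᵥ v :=
  Finset.sum_nonneg fun i _ => mul_self_nonneg (v i)

/-- The dot product of `A v` with itself is the quadratic form of the Gram matrix `Aᵀ A`. -/
theorem mulVec_dotProduct_mulVec_self {m n : Type*} [Fintype m] [Fintype n]
    (A : Matrix m n ℝ) (v : n → ℝ) :
    A *ᵥ v ⬝ᵥ A *ᵥ v = v ⬝ᵥ (Aᵀ * A) *ᵥ v := by
  rw [← mulVec_mulVec, dotProduct_mulVec v, vecMul_transpose]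

section Rayleigh

variable {n : Type*} [Fintype n] [DecidableEq n] {A : Matrix n n ℝ}

theorem lamMin_mul_le_dotProduct_mulVec (hA : A.IsHermitian) (v : n → ℝ) :
    lamMin A * (v ⬝ᵥ v) ≤ v ⬝ᵥ A *ᵥ v := by
  have h : (A - algebraMap ℝ (Matrix n n ℝ) (lamMin A)).PosSemidef := by
    refine posSemidef_iff_isHermitian_and_spectrum_nonneg.2 ⟨hA.sub ?_, ?_⟩
    · simp [IsHermitian, algebraMap_eq_diagonal, diagonal_transpose]
    · rw [← spectrum.sub_singleton_eq]
      rintro _ ⟨μ, hμ, _, rfl, rfl⟩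
      exact sub_nonneg.2 (csInf_le A.finite_real_spectrum.bddBelow hμ)
  have := h.dotProduct_mulVec_nonneg v
  simp only [star_trivial, Algebra.algebraMap_eq_smul_one, sub_mulVec, smul_mulVec, one_mulVec,
    dotProduct_sub, dotProduct_smul, smul_eq_mul] at this
  linarith

theorem dotProduct_mulVec_le_lamMax_mul (hA : A.IsHermitian) (v : n → ℝ) :
    v ⬝ᵥ A *ᵥ v ≤ lamMax A * (v ⬝ᵥ v) := by
  have h : (algebraMap ℝ (Matrix n n ℝ) (lamMax A) - A).PosSemidef := by
    refine posSemidef_iff_isHermitian_and_spectrum_nonneg.2 ⟨IsHermitian.sub ?_ hA, ?_⟩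
    · simp [IsHermitian, algebraMap_eq_diagonal, diagonal_transpose]
    · rw [← spectrum.singleton_sub_eq]
      rintro _ ⟨_, rfl, μ, hμ, rfl⟩
      exact sub_nonneg.2 (le_csSup A.finite_real_spectrum.bddAbove hμ)
  have := h.dotProduct_mulVec_nonneg v
  simp only [star_trivial, Algebra.algebraMap_eq_smul_one, sub_mulVec, smul_mulVec, one_mulVec,
    dotProduct_sub, dotProduct_smul, smul_eq_mul] at this
  linarith

theorem spectrum_nonempty_of_isHermitian [Nonempty n] (hA : A.IsHermitian) :
    (spectrum ℝ A).Nonempty :=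
  ⟨_, hA.eigenvalues_mem_spectrum_real (Classical.arbitrary n)⟩

theorem lamMin_pos [Nonempty n] (hA : A.PosDef) : 0 < lamMin A := by
  have h := (spectrum_nonempty_of_isHermitian hA.1).csInf_mem A.finite_real_spectrum
  rw [hA.1.spectrum_real_eq_range_eigenvalues] at h
  obtain ⟨i, hi⟩ := h
  rw [lamMin, hA.1.spectrum_real_eq_range_eigenvalues, ← hi]
  exact hA.eigenvalues_pos i

theorem lamMin_le_lamMax [Nonempty n] (hA : A.IsHermitian) : lamMin A ≤ lamMax A :=
  csInf_le_csSup (spectrum_nonempty_of_isHermitian hA) A.finite_real_spectrum.bddBelow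
    A.finite_real_spectrum.bddAbove

end Rayleigh

/-- Restricting a vector supported on `J` to `J` does not change its image. -/
theorem submatrix_mulVec_restrict {m n : Type*} [Fintype n] (Φ : Matrix m n ℝ)
    (J : Finset n) (s : n → ℝ) (hs : ∀ i ∉ J, s i = 0) :
    Φ.submatrix id (Subtype.val : {i // i ∈ J} → n) *ᵥ (fun i => s i) = Φ *ᵥ s := by
  ext k
  simp only [mulVec, dotProduct, submatrix_apply, id_eq]
  rw [Finset.sum_coe_sort J fun i => Φ k i * s i]
  exact Finset.sum_subset (Finset.subset_univ J) fun i _ hi => by rw [hs i hi, mul_zero]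

theorem dotProduct_restrict_self {n : Type*} [Fintype n]
    (J : Finset n) (s : n → ℝ) (hs : ∀ i ∉ J, s i = 0) :
    (fun i : {i // i ∈ J} => s i) ⬝ᵥ (fun i : {i // i ∈ J} => s i) = s ⬝ᵥ s := by
  simp only [dotProduct]
  rw [Finset.sum_coe_sort J fun i => s i * s i]
  exact Finset.sum_subset (Finset.subset_univ J) fun i _ hi => by rw [hs i hi, mul_zero]

/-- if `s` is supported on `J` and `Φ_J` is the column submatrix of `Φ` indexed
by `J`, then `λ_min(Φ_Jᵀ Φ_J) ‖s‖₂² / λ_max(Φ Φᵀ) ≤ ‖Q s‖₂² ≤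
λ_max(Φ_Jᵀ Φ_J) ‖s‖₂² / λ_min(Φ Φᵀ)` for `Q = Φᵀ (Φ Φᵀ)⁻¹ Φ`. -/
theorem projected_energy_eigenvalue_bounds {M N : ℕ} (hM : 1 ≤ M) (hMN : M ≤ N)
    (Φ : Matrix (Fin M) (Fin N) ℝ) (hinv : IsUnit (Φ * Φᵀ))
    (J : Finset (Fin N)) (s : Fin N → ℝ) (hs : ∀ i ∉ J, s i = 0) :
    lamMin ((Φ.submatrix id (Subtype.val : {i // i ∈ J} → Fin N))ᵀ *
        (Φ.submatrix id (Subtype.val : {i // i ∈ J} → Fin N))) * (euclNorm s) ^ 2 /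
        lamMax (Φ * Φᵀ) ≤
      (euclNorm ((Φᵀ * (Φ * Φᵀ)⁻¹ * Φ).mulVec s)) ^ 2 ∧
    (euclNorm ((Φᵀ * (Φ * Φᵀ)⁻¹ * Φ).mulVec s)) ^ 2 ≤
      lamMax ((Φ.submatrix id (Subtype.val : {i // i ∈ J} → Fin N))ᵀ *
        (Φ.submatrix id (Subtype.val : {i // i ∈ J} → Fin N))) * (euclNorm s) ^ 2 /
        lamMin (Φ * Φᵀ) := by
  have : Nonempty (Fin M) := ⟨⟨0, hM⟩⟩
  set H := Φ * Φᵀ with hH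
  have hpsd : H.PosSemidef := by
    simpa [hH] using posSemidef_self_mul_conjTranspose Φ
  have hpd : H.PosDef := hpsd.posDef_iff_isUnit.2 hinv
  have hmin : 0 < lamMin H := lamMin_pos hpd
  have hmax : 0 < lamMax H := hmin.trans_le (lamMin_le_lamMax hpd.1)
  set ΦJ := Φ.submatrix id (Subtype.val : {i // i ∈ J} → Fin N)
  have hG : (ΦJᵀ * ΦJ).IsHermitian := by
    simpa using isHermitian_conjTranspose_mul_self ΦJ
  set y := Φ *ᵥ s with hy
  set z := H⁻¹ *ᵥ y with hz
  have hHz : H *ᵥ z = y := by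
    rw [hz, mulVec_mulVec, mul_nonsing_inv _ ((isUnit_iff_isUnit_det H).1 hinv), one_mulVec]
  have hQ : (Φᵀ * H⁻¹ * Φ) *ᵥ s = Φᵀ *ᵥ z := by
    rw [hz, hy, mulVec_mulVec, mulVec_mulVec, Matrix.mul_assoc]
  have hyJ : y ⬝ᵥ y = (fun i : {i // i ∈ J} => s i) ⬝ᵥ (ΦJᵀ * ΦJ) *ᵥ (fun i => s i) := by
    rw [← mulVec_dotProduct_mulVec_self, submatrix_mulVec_restrict Φ J s hs]
  have hlow := lamMin_mul_le_dotProduct_mulVec hG fun i => s i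
  have hupp := dotProduct_mulVec_le_lamMax_mul hG fun i => s i
  rw [← hyJ, dotProduct_restrict_self J s hs] at hlow hupp
  rw [euclNorm_sq, euclNorm_sq, hQ]
  have hb : Φᵀ *ᵥ z ⬝ᵥ Φᵀ *ᵥ z = z ⬝ᵥ y := by
    rw [mulVec_dotProduct_mulVec_self, transpose_transpose, ← hH, hHz]
  have hb0 := dotProduct_self_nonneg' (Φᵀ *ᵥ z)
  have hc0 := dotProduct_self_nonneg' y
  constructor
  · rw [div_le_iff₀ hmax]
    refine hlow.trans ?_
    have hyy : y ⬝ᵥ y = Φᵀ *ᵥ y ⬝ᵥ Φᵀ *ᵥ z := by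
      rw [mulVec_transpose Φ y, ← dotProduct_mulVec, mulVec_mulVec, ← hH, hHz]
    have hcs := dotProduct_sq_le (Φᵀ *ᵥ y) (Φᵀ *ᵥ z)
    have hray := dotProduct_mulVec_le_lamMax_mul hpd.1 y
    rw [← hyy, mulVec_dotProduct_mulVec_self Φᵀ y, transpose_transpose, ← hH] at hcs
    have := hcs.trans (mul_le_mul_of_nonneg_right hray hb0)
    rcases hc0.eq_or_lt with h | h
    · rw [← h]; positivity
    · exact le_of_mul_le_mul_left (by linarith) h
  · rw [le_div_iff₀ hmin]
    refine le_trans ?_ hupp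
    have hcs := dotProduct_sq_le z y
    have hray := lamMin_mul_le_dotProduct_mulVec hpd.1 z
    rw [hHz] at hray
    rw [hb] at hb0 ⊢
    rcases hb0.eq_or_lt with h | h
    · rw [← h, zero_mul]; exact hc0
    · refine le_of_mul_le_mul_left ?_ h
      calc z ⬝ᵥ y * (z ⬝ᵥ y * lamMin H) = lamMin H * (z ⬝ᵥ y) ^ 2 := by ring
        _ ≤ lamMin H * ((z ⬝ᵥ z) * (y ⬝ᵥ y)) := by gcongr
        _ = lamMin H * (z ⬝ᵥ z) * (y ⬝ᵥ y) := by ring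
        _ ≤ z ⬝ᵥ y * (y ⬝ᵥ y) := by gcongr
end

section
/- Let Φ be a real M×N matrix (M ≤ N) with Φ Φᵀ invertible which satisfies the restricted isometry property of order K with constant δ ∈ (0,1), and suppose additionally that λ_max(Φᵀ Φ) ≤ 1 + δ N / K. Then for every s ∈ ℝ^N with at most K nonzero entries, ‖Q s‖₂² ≥ (1−δ) ‖s‖₂² / (1 + δ N / K), where Q = Φᵀ (Φ Φᵀ)⁻¹ Φ. (This is the deterministic core of the delay bound for random Toeplitz sensing matrices: the Kullback–Leibler number ‖Qs‖₂²/(2σ²) is at least (SNR/2)·(1−δ)/(1+δN/K).) -/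
open Matrix

/-- Rayleigh quotient bound: the quadratic form of a real symmetric matrix is at most `lamMax`
times the squared norm. -/
theorem Matrix.IsHermitian.dotProduct_mulVec_le_lamMax {n : Type*} [Fintype n] [DecidableEq n]
    {A : Matrix n n ℝ} (hA : A.IsHermitian) (v : n → ℝ) :
    v ⬝ᵥ A *ᵥ v ≤ lamMax A * (v ⬝ᵥ v) := by
  have h : (algebraMap ℝ (Matrix n n ℝ) (lamMax A) - A).PosSemidef := by
    refine Matrix.posSemidef_iff_isHermitian_and_spectrum_nonneg.2 ⟨?_, ?_⟩
    · refine Matrix.IsHermitian.sub ?_ hA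
      rw [Algebra.algebraMap_eq_smul_one]
      simp [Matrix.IsHermitian]
    · rw [← spectrum.singleton_sub_eq]
      rintro _ ⟨_, rfl, x, hx, rfl⟩
      exact sub_nonneg.2 (le_csSup A.finite_real_spectrum.bddAbove hx)
  have h' := h.dotProduct_mulVec_nonneg v
  rw [Algebra.algebraMap_eq_smul_one, sub_mulVec, smul_mulVec, one_mulVec, dotProduct_sub,
    dotProduct_smul, star_trivial, smul_eq_mul] at h'
  linarith

/-- if `Φ` has invertible `Φ Φᵀ`, satisfies the RIP of order `K` with
constant `δ ∈ (0,1)`, and `λ_max(Φᵀ Φ) ≤ 1 + δ N / K`, then for every `K`-sparse `s`,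
`‖Q s‖₂² ≥ (1−δ)‖s‖₂²/(1 + δ N / K)` for `Q = Φᵀ (Φ Φᵀ)⁻¹ Φ`. -/
theorem toeplitz_projected_energy_lower_bound {M N K : ℕ} (hMN : M ≤ N) (hK : 0 < K)
    (Φ : Matrix (Fin M) (Fin N) ℝ) (hinv : IsUnit (Φ * Φᵀ))
    (δ : ℝ) (hδ : δ ∈ Set.Ioo (0 : ℝ) 1)
    (hRIP : ∀ x : Fin N → ℝ, ({i | x i ≠ 0} : Set (Fin N)).toFinset.card ≤ K →
      (1 - δ) * (euclNorm x) ^ 2 ≤ (euclNorm (Φ.mulVec x)) ^ 2 ∧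
      (euclNorm (Φ.mulVec x)) ^ 2 ≤ (1 + δ) * (euclNorm x) ^ 2)
    (hmax : lamMax (Φᵀ * Φ) ≤ 1 + δ * N / K)
    (s : Fin N → ℝ) (hs : ({i | s i ≠ 0} : Set (Fin N)).toFinset.card ≤ K) :
    (1 - δ) * (euclNorm s) ^ 2 / (1 + δ * N / K) ≤
      (euclNorm ((Φᵀ * (Φ * Φᵀ)⁻¹ * Φ).mulVec s)) ^ 2 := by
  set w := (Φᵀ * (Φ * Φᵀ)⁻¹ * Φ) *ᵥ s with hw
  have hΦw : Φ *ᵥ w = Φ *ᵥ s := by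
    rw [hw, mulVec_mulVec, ← Matrix.mul_assoc, ← Matrix.mul_assoc,
      Matrix.mul_nonsing_inv _ ((Matrix.isUnit_iff_isUnit_det _).1 hinv), Matrix.one_mul]
  have hpos : 0 < 1 + δ * N / K := by
    have := hδ.1
    positivity
  have hA : (Φᵀ * Φ).IsHermitian := by
    simpa using Matrix.isHermitian_conjTranspose_mul_self Φ
  rw [div_le_iff₀ hpos]
  calc (1 - δ) * euclNorm s ^ 2 ≤ euclNorm (Φ *ᵥ s) ^ 2 := (hRIP s hs).1
    _ = w ⬝ᵥ (Φᵀ * Φ) *ᵥ w := by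
      rw [← hΦw, euclNorm_sq, ← mulVec_mulVec, dotProduct_mulVec w, vecMul_transpose]
    _ ≤ lamMax (Φᵀ * Φ) * (w ⬝ᵥ w) := hA.dotProduct_mulVec_le_lamMax w
    _ = euclNorm w ^ 2 * lamMax (Φᵀ * Φ) := by rw [euclNorm_sq, mul_comm]
    _ ≤ euclNorm w ^ 2 * (1 + δ * N / K) := mul_le_mul_of_nonneg_left hmax (sq_nonneg _)
end
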